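/- arXiv:1803.03752 — 5 statements merged into one kernel-verified Lean document; each statement's English description precedes it below -/
import Mathlib

section
/- Let [(S_i,r_i)]_{i=1}^m ∈ 𝒮_{k,m,n} satisfy the GM-MDS condition, and suppose Ω_1 ⊆ {1,…,m} with 2 ≤ |Ω_1| ≤ m − 1 satisfies the equality |∩_{i∈Ω_1} S_i| + ∑_{i∈Ω_1} r_i = max_{i∈Ω_1}(|S_i| + r_i). Set S_0 = ∩_{i∈Ω_1} S_i, r_0 = ∑_{i∈Ω_1} r_i, and S'_i = S_i ∖ S_0 for i ∈ Ω_1. Then: (a) the family [(S'_i,r_i)]_{i∈Ω_1} belongs to 𝒮_{r_0,|Ω_1|,n} and satisfies the GM-MDS condition; and (b) the family consisting of (S_0,r_0) together with [(S_i,r_i)]_{i∈{1,…,m}∖Ω_1} belongs to 𝒮_{k,m−|Ω_1|+1,n} and satisfies the GM-MDS condition. -/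
/-- **Case 1, combinatorial part.** Suppose `[(S_i,r_i)]_{i=1}^m ∈ 𝒮_{k,m,n}`
satisfies the GM-MDS condition and `Ω_1 ⊆ [m]` with `2 ≤ |Ω_1| ≤ m-1` attains
equality `|⋂_{i∈Ω_1} S_i| + ∑_{i∈Ω_1} r_i = max_{i∈Ω_1}(|S_i|+r_i)`.  With
`S_0 = ⋂_{i∈Ω_1} S_i`, `r_0 = ∑_{i∈Ω_1} r_i` and `S'_i = S_i ∖ S_0`:
(a) the family `[(S'_i,r_i)]_{i∈Ω_1}` lies in `𝒮_{r_0,|Ω_1|,n}` and satisfies the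
GM-MDS condition; and (b) the family consisting of `(S_0,r_0)` together with
`[(S_i,r_i)]_{i∈[m]∖Ω_1}` (indexed below by `Option {i // i ∈ univ \ Ω_1}`, with
`none ↦ (S_0,r_0)`) lies in `𝒮_{k,m-|Ω_1|+1,n}` and satisfies the GM-MDS
condition. -/
theorem stmt_9 {k m n : ℕ} (hm : 1 ≤ m) (hmk : m ≤ k)
    (S : Fin m → Finset (Fin n)) (r : Fin m → ℕ)
    (hr : ∀ i, 1 ≤ r i) (hcard : ∀ i, (S i).card + r i ≤ k) (hsum : ∑ i, r i = k)
    (hgm : ∀ Ω : Finset (Fin m), Ω.Nonempty →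
      (Ω.inf S).card + ∑ i ∈ Ω, r i ≤ Ω.sup fun i => (S i).card + r i)
    (Ω1 : Finset (Fin m)) (h2 : 2 ≤ Ω1.card) (h1 : Ω1.card ≤ m - 1)
    (heq : (Ω1.inf S).card + ∑ i ∈ Ω1, r i = Ω1.sup fun i => (S i).card + r i) :
    -- (a)
    ((∀ i ∈ Ω1, (S i \ Ω1.inf S).card + r i ≤ ∑ i ∈ Ω1, r i) ∧
     (∀ Ω ⊆ Ω1, Ω.Nonempty →
        (Ω.inf fun i => S i \ Ω1.inf S).card + ∑ i ∈ Ω, r i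
          ≤ Ω.sup fun i => (S i \ Ω1.inf S).card + r i)) ∧
    -- (b)
    ((∀ o : Option {i // i ∈ Finset.univ \ Ω1},
        1 ≤ o.elim (∑ i ∈ Ω1, r i) fun i => r i.1) ∧
     (∀ o : Option {i // i ∈ Finset.univ \ Ω1},
        (o.elim (Ω1.inf S) fun i => S i.1).card
          + o.elim (∑ i ∈ Ω1, r i) (fun i => r i.1) ≤ k) ∧
     (∑ o : Option {i // i ∈ Finset.univ \ Ω1},
        o.elim (∑ i ∈ Ω1, r i) (fun i => r i.1) = k) ∧
     (∀ Θ : Finset (Option {i // i ∈ Finset.univ \ Ω1}), Θ.Nonempty →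
        (Θ.inf fun o => o.elim (Ω1.inf S) fun i => S i.1).card
            + ∑ o ∈ Θ, o.elim (∑ i ∈ Ω1, r i) (fun i => r i.1)
          ≤ Θ.sup fun o => (o.elim (Ω1.inf S) fun i => S i.1).card
            + o.elim (∑ i ∈ Ω1, r i) fun i => r i.1)) := by
  have hsub : ∀ i ∈ Ω1, Ω1.inf S ⊆ S i := fun i hi => Finset.inf_le (f := S) hi
  have hne : Ω1.Nonempty := Finset.card_pos.mp (by omega)
  have hdiff : ∀ i ∈ Ω1, (S i \ Ω1.inf S).card + (Ω1.inf S).card = (S i).card :=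
    fun i hi => Finset.card_sdiff_add_card_eq_card (hsub i hi)
  refine ⟨⟨fun i hi => ?_, fun Ω hΩ hΩne => ?_⟩, fun o => ?_, fun o => ?_, ?_, fun Θ hΘ => ?_⟩
  · have hle := Finset.le_sup (f := fun i => (S i).card + r i) hi
    have hd := hdiff i hi
    omega
  · obtain ⟨j, hj, hjsup⟩ := Finset.exists_mem_eq_sup Ω hΩne fun i => (S i).card + r i
    have hinf : (Ω.inf fun i => S i \ Ω1.inf S) ⊆ Ω.inf S \ Ω1.inf S := by
      intro x hx
      rw [Finset.mem_inf] at hx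
      obtain ⟨j, hj⟩ := hΩne
      rw [Finset.mem_sdiff, Finset.mem_inf]
      exact ⟨fun i hi => (Finset.mem_sdiff.mp (hx i hi)).1, (Finset.mem_sdiff.mp (hx j hj)).2⟩
    have hcardle := Finset.card_le_card hinf
    have hcardeq := Finset.card_sdiff_add_card_eq_card
      (show Ω1.inf S ⊆ Ω.inf S from Finset.inf_mono hΩ)
    have hg := hgm Ω hΩne
    have hle := Finset.le_sup (f := fun i => (S i \ Ω1.inf S).card + r i) hj
    have hd := hdiff j (hΩ hj)
    omega
  · cases o with
    | none =>
      obtain ⟨i, hi⟩ := hne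
      exact (hr i).trans (Finset.single_le_sum (fun _ _ => Nat.zero_le _) hi)
    | some i => exact hr i.1
  · cases o with
    | none => exact heq.le.trans (Finset.sup_le fun i _ => hcard i)
    | some i => exact hcard i.1
  · rw [Fintype.sum_option, ← hsum, ← Finset.sum_sdiff (Finset.subset_univ Ω1), add_comm]
    simp only [Option.elim]
    rw [Finset.sum_coe_sort (Finset.univ \ Ω1) r]
  · let block : Option {i // i ∈ Finset.univ \ Ω1} → Finset (Fin m) :=
      fun o => o.elim Ω1 fun i => {i.1}
    have hinf : (Θ.biUnion block).inf S = Θ.inf fun o => o.elim (Ω1.inf S) fun i => S i.1 := by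
      rw [Finset.inf_biUnion]
      refine Finset.inf_congr rfl fun o _ => ?_
      cases o <;> simp [block]
    have hsup : ((Θ.biUnion block).sup fun i => (S i).card + r i) =
        Θ.sup fun o => (o.elim (Ω1.inf S) fun i => S i.1).card
          + o.elim (∑ i ∈ Ω1, r i) fun i => r i.1 := by
      rw [Finset.sup_biUnion]
      refine Finset.sup_congr rfl fun o _ => ?_
      cases o with
      | none => exact heq.symm
      | some i => simp [block]
    have hdisj : (Θ : Set (Option {i // i ∈ Finset.univ \ Ω1})).PairwiseDisjoint block := by
      rintro (_ | ⟨i, hi⟩) _ (_ | ⟨j, hj⟩) _ hij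
      · exact absurd rfl hij
      · exact Finset.disjoint_singleton_right.mpr (Finset.mem_sdiff.mp hj).2
      · exact Finset.disjoint_singleton_left.mpr (Finset.mem_sdiff.mp hi).2
      · exact Finset.disjoint_singleton.mpr fun h => hij (by subst h; rfl)
    have hsumblock : ∑ i ∈ Θ.biUnion block, r i =
        ∑ o ∈ Θ, o.elim (∑ i ∈ Ω1, r i) (fun i => r i.1) := by
      rw [Finset.sum_biUnion hdisj]
      refine Finset.sum_congr rfl fun o _ => ?_
      cases o <;> simp [block]
    have hblock : (Θ.biUnion block).Nonempty :=
      hΘ.biUnion fun o _ => by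
        cases o with
        | none => exact hne
        | some i => exact Finset.singleton_nonempty _
    rw [← hinf, ← hsup, ← hsumblock]
    exact hgm _ hblock
end

section
/- Let [(S_i,r_i)]_{i=1}^m ∈ 𝒮_{k,m,n}, and suppose Ω_1 ⊆ {1,…,m} with 2 ≤ |Ω_1| ≤ m − 1 satisfies the equality |∩_{i∈Ω_1} S_i| + ∑_{i∈Ω_1} r_i = max_{i∈Ω_1}(|S_i| + r_i). Set S_0 = ∩_{i∈Ω_1} S_i, r_0 = ∑_{i∈Ω_1} r_i, and S'_i = S_i ∖ S_0 for i ∈ Ω_1. If det M[(S'_i,r_i)]_{i∈Ω_1} ≠ 0 (an r_0 × r_0 matrix built with the parameter r_0 in place of k) and the determinant of the k×k matrix M built from the family consisting of (S_0,r_0) together with [(S_i,r_i)]_{i∈{1,…,m}∖Ω_1} is nonzero, then det M[(S_i,r_i)]_{i=1}^m ≠ 0. -/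
open Polynomial

/-- `Kn n` is the field `K_n = ℚ(α_1,…,α_n)` of rational functions in `n`
indeterminates over `ℚ` (for `n = 0` it is just `ℚ` up to isomorphism). -/
noncomputable abbrev Kn (n : ℕ) : Type := FractionRing (MvPolynomial (Fin n) ℚ)

/-- The indeterminate `α_j` viewed as an element of `K_n`. -/
noncomputable def alf {n : ℕ} (j : Fin n) : Kn n :=
  algebraMap (MvPolynomial (Fin n) ℚ) (Kn n) (MvPolynomial.X j)

/-- The degree-`(k-1)` polynomial `x^(k-|S|-1) * ∏_{j ∈ S} (x + α_j)` whose
coefficients form the rows of a block of the matrix `M`. -/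
noncomputable def rowPoly {n : ℕ} (k : ℕ) (S : Finset (Fin n)) : Polynomial (Kn n) :=
  X ^ (k - S.card - 1) * ∏ j ∈ S, (X + C (alf j))

/-- The row offset of block `i`, namely `r_1 + ⋯ + r_{i-1}`. -/
def off {m : ℕ} (r : Fin m → ℕ) (i : Fin m) : ℕ :=
  ∑ j ∈ Finset.univ.filter (· < i), r j

/-- The `k × k` matrix `M[(S_i,r_i)]_{i=1}^m` over `K_n`: rows are grouped into `m`
blocks, block `i` consisting of the `r i` rows with (0-based) indices
`off r i ≤ ρ < off r i + r i`.  Writing `t = ρ - off r i` (so `0 ≤ t ≤ r i - 1`),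
the entry of such a row in (0-based) column `c` is the coefficient of
`x^(k-1-c+t)` in `rowPoly k (S i)` when `t ≤ c`, and `0` when `c < t`.
(When `∑ i, r i = k` the blocks exactly partition the `k` rows, so for each row
exactly one summand below is active.) -/
noncomputable def gmM {n m : ℕ} (k : ℕ) (S : Fin m → Finset (Fin n)) (r : Fin m → ℕ) :
    Matrix (Fin k) (Fin k) (Kn n) :=
  Matrix.of fun ρ c => ∑ i : Fin m,
    if off r i ≤ (ρ : ℕ) ∧ (ρ : ℕ) < off r i + r i ∧ (ρ : ℕ) - off r i ≤ (c : ℕ)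
    then (rowPoly k (S i)).coeff (k - 1 - (c : ℕ) + ((ρ : ℕ) - off r i)) else 0

/-- The monic polynomial `∏_{j ∈ S} (x + α_j)`. -/
noncomputable def rootPoly {n : ℕ} (S : Finset (Fin n)) : (Kn n)[X] :=
  ∏ j ∈ S, (X + C (alf j))

lemma rootPoly_monic {n : ℕ} (S : Finset (Fin n)) : (rootPoly S).Monic :=
  monic_prod_of_monic _ _ fun j _ => monic_X_add_C (alf j)

lemma natDegree_rootPoly {n : ℕ} (S : Finset (Fin n)) : (rootPoly S).natDegree = S.card := by
  rw [rootPoly, natDegree_prod_of_monic _ _ fun j _ => monic_X_add_C (alf j)]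
  simp

lemma natDegree_X_pow_mul_rootPoly {n : ℕ} (s : ℕ) (S : Finset (Fin n)) :
    (X ^ s * rootPoly S).natDegree = s + S.card := by
  rw [(monic_X_pow s).natDegree_mul (rootPoly_monic S), natDegree_X_pow, natDegree_rootPoly]

/-- The first `k` coefficients of a polynomial, in descending order of degree. -/
noncomputable def descCoeffs (K : Type*) [Field K] (k : ℕ) : K[X] →ₗ[K] (Fin k → K) :=
  LinearMap.pi fun c => lcoeff K (k - 1 - (c : ℕ))

lemma descCoeffs_apply {K : Type*} [Field K] {k : ℕ} (p : K[X]) (c : Fin k) :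
    descCoeffs K k p c = p.coeff (k - 1 - (c : ℕ)) := rfl

lemma descCoeffs_injOn {K : Type*} [Field K] {k : ℕ} {p q : K[X]}
    (hp : p ∈ degreeLT K k) (hq : q ∈ degreeLT K k)
    (h : descCoeffs K k p = descCoeffs K k q) : p = q := by
  ext e
  by_cases he : e < k
  · have := congrFun h ⟨k - 1 - e, by omega⟩
    rw [descCoeffs_apply, descCoeffs_apply] at this
    rwa [show k - 1 - (k - 1 - e) = e by omega] at this
  · rw [mem_degreeLT] at hp hq
    have hke : (k : WithBot ℕ) ≤ e := by exact_mod_cast not_lt.mp he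
    rw [coeff_eq_zero_of_degree_lt (hp.trans_le hke), coeff_eq_zero_of_degree_lt (hq.trans_le hke)]

/-- The polynomials whose coefficient vectors are the rows of the block `(S, r)`. -/
def blockPolys {n : ℕ} (k : ℕ) (S : Finset (Fin n)) (r : ℕ) : Set (Kn n)[X] :=
  {p | ∃ s, k ≤ s + S.card + r ∧ s + S.card < k ∧ p = X ^ s * rootPoly S}

lemma blockPolys_subset_degreeLT {n : ℕ} (k : ℕ) (S : Finset (Fin n)) (r : ℕ) :
    blockPolys k S r ⊆ degreeLT (Kn n) k := by
  rintro _ ⟨s, -, hs, rfl⟩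
  rw [SetLike.mem_coe, mem_degreeLT,
    degree_eq_natDegree ((monic_X_pow s).mul (rootPoly_monic S)).ne_zero,
    natDegree_X_pow_mul_rootPoly]
  exact_mod_cast hs

lemma rowPoly_entry {n k t : ℕ} (S : Finset (Fin n)) (ht : S.card + t < k) (c : Fin k) :
    (if t ≤ (c : ℕ) then (rowPoly k S).coeff (k - 1 - (c : ℕ) + t) else 0) =
      descCoeffs (Kn n) k (X ^ (k - S.card - 1 - t) * rootPoly S) c := by
  have hc := c.isLt
  rw [descCoeffs_apply]
  split_ifs with h
  · have : rowPoly k S = X ^ t * (X ^ (k - S.card - 1 - t) * rootPoly S) := by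
      rw [← mul_assoc, ← pow_add, show t + (k - S.card - 1 - t) = k - S.card - 1 by omega]
      rfl
    rw [this, add_comm _ t, add_comm t, coeff_X_pow_mul]
  · rw [coeff_eq_zero_of_natDegree_lt]
    rw [natDegree_X_pow_mul_rootPoly]
    omega

lemma off_add_le_off {m : ℕ} (r : Fin m → ℕ) {i j : Fin m} (h : i < j) :
    off r i + r i ≤ off r j := by
  unfold off
  rw [add_comm, ← Finset.sum_insert (by simp)]
  refine Finset.sum_le_sum_of_subset fun a ha => ?_
  simp only [Finset.mem_insert, Finset.mem_filter, Finset.mem_univ, true_and] at ha ⊢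
  rcases ha with rfl | ha
  · exact h
  · exact ha.trans h

lemma off_add_le_sum {m : ℕ} (r : Fin m → ℕ) (i : Fin m) : off r i + r i ≤ ∑ j, r j := by
  unfold off
  rw [add_comm, ← Finset.sum_insert (by simp)]
  exact Finset.sum_le_sum_of_subset (Finset.subset_univ _)

lemma gmM_row_mem_span {n m k : ℕ} {S : Fin m → Finset (Fin n)} {r : Fin m → ℕ}
    (hcard : ∀ i, (S i).card + r i ≤ k) (ρ : Fin k) :
    (gmM k S r).row ρ ∈
      (Submodule.span (Kn n) (⋃ i, blockPolys k (S i) (r i))).map (descCoeffs (Kn n) k) := by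
  have hrow : (gmM k S r).row ρ = ∑ i : Fin m,
      if off r i ≤ (ρ : ℕ) ∧ (ρ : ℕ) < off r i + r i then
        descCoeffs (Kn n) k
          (X ^ (k - (S i).card - 1 - ((ρ : ℕ) - off r i)) * rootPoly (S i)) else 0 := by
    ext c
    simp only [gmM, Matrix.row, Matrix.of_apply, Finset.sum_apply]
    refine Finset.sum_congr rfl fun i _ => ?_
    by_cases h : off r i ≤ (ρ : ℕ) ∧ (ρ : ℕ) < off r i + r i
    · rw [if_pos h, ← rowPoly_entry (S i) (by have := hcard i; omega) c]
      simp only [h.1, h.2, true_and]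
    · rw [if_neg h, if_neg (fun h' => h ⟨h'.1, h'.2.1⟩)]
      rfl
  rw [hrow]
  refine Submodule.sum_mem _ fun i _ => ?_
  split_ifs with h
  · refine Submodule.mem_map_of_mem (Submodule.subset_span (Set.mem_iUnion.mpr ⟨i, _, ?_, ?_, rfl⟩))
    all_goals have := hcard i; omega
  · exact Submodule.zero_mem _

lemma descCoeffs_mem_range_row {n m k : ℕ} {S : Fin m → Finset (Fin n)} {r : Fin m → ℕ}
    (hsum : ∑ i, r i = k) {i : Fin m} {p : (Kn n)[X]}
    (hp : p ∈ blockPolys k (S i) (r i)) :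
    descCoeffs (Kn n) k p ∈ Set.range (gmM k S r).row := by
  obtain ⟨s, hs, hs', rfl⟩ := hp
  have hi := off_add_le_sum r i
  refine ⟨⟨off r i + (k - (S i).card - 1 - s), by omega⟩, ?_⟩
  ext c
  simp only [gmM, Matrix.row, Matrix.of_apply]
  rw [Finset.sum_eq_single i]
  · have ht := rowPoly_entry (S i) (t := k - (S i).card - 1 - s) (by omega) c
    rw [show k - (S i).card - 1 - (k - (S i).card - 1 - s) = s by omega] at ht
    rw [← ht, Nat.add_sub_cancel_left]
    refine if_congr ⟨fun h => h.2.2, fun h => ⟨by omega, by omega, h⟩⟩ rfl rfl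
  · intro j _ hj
    refine if_neg fun h => ?_
    rcases lt_or_gt_of_ne hj with hlt | hlt
    · have := off_add_le_off r hlt
      omega
    · have := off_add_le_off r hlt
      omega
  · simp

lemma det_ne_zero_iff_span_row_eq_top {K : Type*} [Field K] {k : ℕ}
    (A : Matrix (Fin k) (Fin k) K) :
    A.det ≠ 0 ↔ Submodule.span K (Set.range A.row) = ⊤ := by
  rw [← isUnit_iff_ne_zero, ← Matrix.isUnit_iff_isUnit_det,
    ← Matrix.linearIndependent_rows_iff_isUnit, linearIndependent_iff_card_eq_finrank_span, Set.finrank]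
  constructor
  · intro h
    exact Submodule.eq_top_of_finrank_eq (by rw [← h]; simp)
  · intro h
    rw [h]
    simp

/-- The matrix of a family is invertible iff the coefficient vectors of its block polynomials
span the whole space. -/
lemma det_gmM_ne_zero_iff {n m k : ℕ} {S : Fin m → Finset (Fin n)} {r : Fin m → ℕ}
    (hcard : ∀ i, (S i).card + r i ≤ k) (hsum : ∑ i, r i = k) :
    (gmM k S r).det ≠ 0 ↔
      (Submodule.span (Kn n) (⋃ i, blockPolys k (S i) (r i))).map (descCoeffs (Kn n) k) = ⊤ := by
  rw [det_ne_zero_iff_span_row_eq_top]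
  suffices h : Submodule.span (Kn n) (Set.range (gmM k S r).row) =
      (Submodule.span (Kn n) (⋃ i, blockPolys k (S i) (r i))).map (descCoeffs (Kn n) k) by rw [h]
  apply le_antisymm
  · rw [Submodule.span_le]
    rintro _ ⟨ρ, rfl⟩
    exact gmM_row_mem_span hcard ρ
  · rw [Submodule.map_span, Submodule.span_le]
    rintro _ ⟨p, hp, rfl⟩
    obtain ⟨i, hi⟩ := Set.mem_iUnion.mp hp
    exact Submodule.subset_span (descCoeffs_mem_range_row hsum hi)

lemma degreeLT_le_span_blockPolys {n m k : ℕ} {S : Fin m → Finset (Fin n)} {r : Fin m → ℕ}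
    (hcard : ∀ i, (S i).card + r i ≤ k) (hsum : ∑ i, r i = k) (hdet : (gmM k S r).det ≠ 0) :
    degreeLT (Kn n) k ≤ Submodule.span (Kn n) (⋃ i, blockPolys k (S i) (r i)) := by
  intro p hp
  have htop := (det_gmM_ne_zero_iff hcard hsum).mp hdet
  obtain ⟨q, hq, hqp⟩ := htop.symm ▸ Submodule.mem_top (x := descCoeffs (Kn n) k p)
  have hle : Submodule.span (Kn n) (⋃ i, blockPolys k (S i) (r i)) ≤ degreeLT (Kn n) k :=
    Submodule.span_le.mpr (Set.iUnion_subset fun i => blockPolys_subset_degreeLT k (S i) (r i))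
  exact descCoeffs_injOn (hle hq) hp hqp ▸ hq

lemma rootPoly_mul_sdiff {n : ℕ} {S₀ S : Finset (Fin n)} (h : S₀ ⊆ S) :
    rootPoly S₀ * rootPoly (S \ S₀) = rootPoly S := by
  rw [mul_comm]
  exact Finset.prod_sdiff h

lemma mul_mem_blockPolys {n k r₀ r : ℕ} {S₀ S : Finset (Fin n)} (h : S₀ ⊆ S)
    (hk : S₀.card + r₀ ≤ k) {p : (Kn n)[X]} (hp : p ∈ blockPolys r₀ (S \ S₀) r) :
    X ^ (k - (S₀.card + r₀)) * rootPoly S₀ * p ∈ blockPolys k S r := by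
  obtain ⟨s, hs, hs', rfl⟩ := hp
  have hS := Finset.card_sdiff_add_card_eq_card h
  refine ⟨k - (S₀.card + r₀) + s, by omega, by omega, ?_⟩
  rw [pow_add, ← rootPoly_mul_sdiff h]
  ring

/-- If the reduced family has an invertible matrix, the merged block `(S₀, r₀)` lies in the span
of the blocks it was merged from. -/
lemma blockPolys_subset_span {n m k r₀ : ℕ} {S₀ : Finset (Fin n)} {S : Fin m → Finset (Fin n)}
    {r : Fin m → ℕ} (hS : ∀ i, S₀ ⊆ S i) (hcard : ∀ i, (S i).card + r i ≤ S₀.card + r₀)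
    (hk : S₀.card + r₀ ≤ k) (hsum : ∑ i, r i = r₀)
    (hdet : (gmM r₀ (fun i => S i \ S₀) r).det ≠ 0) :
    blockPolys k S₀ r₀ ⊆ Submodule.span (Kn n) (⋃ i, blockPolys k (S i) (r i)) := by
  have hcard' : ∀ i, (S i \ S₀).card + r i ≤ r₀ := fun i => by
    have := Finset.card_sdiff_add_card_eq_card (hS i)
    have := hcard i
    omega
  rintro _ ⟨s, hs, hs', rfl⟩
  have hX : (X : (Kn n)[X]) ^ (s - (k - (S₀.card + r₀))) ∈ degreeLT (Kn n) r₀ := by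
    rw [mem_degreeLT, degree_X_pow]
    exact_mod_cast (by omega : s - (k - (S₀.card + r₀)) < r₀)
  have hmem := Submodule.mem_map_of_mem
    (f := LinearMap.mulLeft (Kn n) (X ^ (k - (S₀.card + r₀)) * rootPoly S₀))
    (degreeLT_le_span_blockPolys hcard' hsum hdet hX)
  rw [Submodule.map_span, LinearMap.mulLeft_apply, mul_right_comm, ← pow_add,
    show k - (S₀.card + r₀) + (s - (k - (S₀.card + r₀))) = s by omega] at hmem
  refine Submodule.span_mono ?_ hmem
  rintro _ ⟨p, hp, rfl⟩
  obtain ⟨i, hi⟩ := Set.mem_iUnion.mp hp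
  exact Set.mem_iUnion.mpr ⟨i, mul_mem_blockPolys (hS i) hk hi⟩

lemma sum_orderEmbOfFin {m : ℕ} (s : Finset (Fin m)) (r : Fin m → ℕ) :
    ∑ a, r (s.orderEmbOfFin rfl a) = ∑ i ∈ s, r i := by
  rw [← Finset.sum_coe_sort s]
  exact Fintype.sum_equiv (s.orderIsoOfFin rfl).toEquiv _ _ fun _ => rfl

/-- **Case 1 of the induction.** Suppose `[(S_i,r_i)]_{i=1}^m ∈ 𝒮_{k,m,n}` and
`Ω_1 ⊆ [m]` with `2 ≤ |Ω_1| ≤ m-1` satisfies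
`|⋂_{i∈Ω_1} S_i| + ∑_{i∈Ω_1} r_i = max_{i∈Ω_1}(|S_i|+r_i)`.
Set `S_0 = ⋂_{i∈Ω_1} S_i`, `r_0 = ∑_{i∈Ω_1} r_i` and `S'_i = S_i \ S_0`.
If the `r_0 × r_0` matrix `M[(S'_i,r_i)]_{i∈Ω_1}` (built with parameter `r_0` in
place of `k`; the members of `Ω_1` are enumerated in increasing order) and the
`k × k` matrix `M` built from `(S_0,r_0)` together with
`[(S_i,r_i)]_{i∈[m]∖Ω_1}` both have nonzero determinant, then
`det M[(S_i,r_i)]_{i=1}^m ≠ 0`. -/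
theorem stmt_10 {k m n : ℕ} (hm : 1 ≤ m) (hmk : m ≤ k)
    (S : Fin m → Finset (Fin n)) (r : Fin m → ℕ)
    (hr : ∀ i, 1 ≤ r i) (hcard : ∀ i, (S i).card + r i ≤ k) (hsum : ∑ i, r i = k)
    (Ω1 : Finset (Fin m)) (h2 : 2 ≤ Ω1.card) (h1 : Ω1.card ≤ m - 1)
    (heq : (Ω1.inf S).card + ∑ i ∈ Ω1, r i = Ω1.sup fun i => (S i).card + r i)
    (hA : (gmM (∑ i ∈ Ω1, r i)
        (fun a : Fin Ω1.card => S (Ω1.orderEmbOfFin rfl a) \ Ω1.inf S)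
        (fun a : Fin Ω1.card => r (Ω1.orderEmbOfFin rfl a))).det ≠ 0)
    (hB : (gmM k
        (Fin.cons (Ω1.inf S) fun a : Fin (Finset.univ \ Ω1).card =>
          S ((Finset.univ \ Ω1).orderEmbOfFin rfl a))
        (Fin.cons (∑ i ∈ Ω1, r i) fun a : Fin (Finset.univ \ Ω1).card =>
          r ((Finset.univ \ Ω1).orderEmbOfFin rfl a))).det ≠ 0) :
    (gmM k S r).det ≠ 0 := by
  have hle : ∀ i ∈ Ω1, (S i).card + r i ≤ (Ω1.inf S).card + ∑ i ∈ Ω1, r i := fun i hi =>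
    heq ▸ Finset.le_sup (f := fun i => (S i).card + r i) hi
  have hk : (Ω1.inf S).card + ∑ i ∈ Ω1, r i ≤ k := heq ▸ Finset.sup_le fun i _ => hcard i
  have hΩ := fun a => Ω1.orderEmbOfFin_mem rfl a
  have hmerged := blockPolys_subset_span (fun a => Finset.inf_le (f := S) (hΩ a))
    (fun a => hle _ (hΩ a)) hk (sum_orderEmbOfFin Ω1 r) hA
  rw [det_gmM_ne_zero_iff (Fin.cases hk fun a => hcard _) ?_] at hB
  · rw [det_gmM_ne_zero_iff hcard hsum, eq_top_iff, ← hB]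
    refine Submodule.map_mono (Submodule.span_le.mpr (Set.iUnion_subset (Fin.cases ?_ fun a => ?_)))
    · refine hmerged.trans (Submodule.span_mono (Set.iUnion_subset fun a => ?_))
      exact Set.subset_iUnion (fun i => blockPolys k (S i) (r i)) (Ω1.orderEmbOfFin rfl a)
    · exact (Set.subset_iUnion (fun i => blockPolys k (S i) (r i)) _).trans Submodule.subset_span
  · rw [Fin.sum_univ_succ]
    simp only [Fin.cons_zero, Fin.cons_succ]
    rw [sum_orderEmbOfFin, add_comm, Finset.sum_sdiff (Finset.subset_univ Ω1), hsum]
end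

section
/- Let [(S_i,r_i)]_{i=1}^m ∈ 𝒮_{k,m,n} with |S_m| + r_m = k and |S_i| + r_i < k for all i ∈ {1,…,m−1}. If r_m ≥ 2, then det M[(S_i,r_i)]_{i=1}^m = (∏_{j∈S_m} α_j) · det M[(S_1,r_1),…,(S_{m−1},r_{m−1}),(S_m,r_m−1)], where the second matrix is the (k−1)×(k−1) matrix built with the parameter k−1 in place of k. If r_m = 1 and m ≥ 2, then det M[(S_i,r_i)]_{i=1}^m = (∏_{j∈S_m} α_j) · det M[(S_i,r_i)]_{i=1}^{m−1}, where the second matrix is the (k−1)×(k−1) matrix built from the first m−1 pairs with the parameter k−1 in place of k. -/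
open Polynomial

theorem Matrix.det_eq_mul_det_submatrix_castSucc {R : Type*} [CommRing R] {k : ℕ}
    (A : Matrix (Fin (k + 1)) (Fin (k + 1)) R)
    (hA : ∀ i : Fin k, A i.castSucc (Fin.last k) = 0) :
    A.det = A (Fin.last k) (Fin.last k) * (A.submatrix Fin.castSucc Fin.castSucc).det := by
  rw [Matrix.det_succ_column A (Fin.last k), Fin.sum_univ_castSucc]
  simp [hA, ← two_mul, pow_mul]

theorem coeff_rowPoly_of_lt {n k t : ℕ} {S : Finset (Fin n)} (h : S.card + t + 1 < k) :
    (rowPoly k S).coeff t = 0 := by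
  rw [rowPoly, coeff_X_pow_mul', if_neg (by omega)]

theorem coeff_rowPoly_of_eq {n k t : ℕ} {S : Finset (Fin n)} (h : S.card + t + 1 = k) :
    (rowPoly k S).coeff t = ∏ j ∈ S, alf j := by
  rw [rowPoly, coeff_X_pow_mul', if_pos (by omega), show t - (k - S.card - 1) = 0 by omega,
    coeff_zero_eq_eval_zero, eval_prod]
  simp

theorem coeff_succ_rowPoly_succ {n k t : ℕ} {S : Finset (Fin n)} (h : S.card + 1 ≤ k) :
    (rowPoly (k + 1) S).coeff (t + 1) = (rowPoly k S).coeff t := by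
  rw [rowPoly, rowPoly, show k + 1 - S.card - 1 = (k - S.card - 1) + 1 by omega, pow_succ',
    mul_assoc, coeff_X_mul]

theorem off_last {m : ℕ} (r : Fin (m + 1) → ℕ) :
    off r (Fin.last m) = ∑ i : Fin m, r i.castSucc := by
  simp [off, Finset.sum_filter, Fin.sum_univ_castSucc, Fin.castSucc_lt_last]

theorem off_castSucc {m : ℕ} (r : Fin (m + 1) → ℕ) (i : Fin m) :
    off r i.castSucc = off (fun a : Fin m => r a.castSucc) i := by
  simp [off, Finset.sum_filter, Fin.sum_univ_castSucc, Fin.not_lt.2 (Fin.le_last _)]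

theorem off_update_last {m : ℕ} (r : Fin (m + 1) → ℕ) (x : ℕ) (i : Fin (m + 1)) :
    off (Function.update r (Fin.last m) x) i = off r i := by
  refine Finset.sum_congr rfl fun j hj => Function.update_of_ne ?_ _ _
  exact ((Finset.mem_filter.1 hj).2.trans_le (Fin.le_last i)).ne

/-- Expansion of `det (gmM (k + 1) S r)` along the last column, whose only nonzero entry is the
bottom one. -/
theorem det_gmM_succ {n k m : ℕ} (S : Fin (m + 1) → Finset (Fin n)) (r : Fin (m + 1) → ℕ)
    (hr : 1 ≤ r (Fin.last m)) (hsum : ∑ i, r i = k + 1)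
    (hlast : (S (Fin.last m)).card + r (Fin.last m) = k + 1)
    (hothers : ∀ i : Fin m, (S i.castSucc).card + r i.castSucc < k + 1) :
    (gmM (k + 1) S r).det = (∏ j ∈ S (Fin.last m), alf j) *
      ((gmM (k + 1) S r).submatrix Fin.castSucc Fin.castSucc).det := by
  have hoff : off r (Fin.last m) + r (Fin.last m) = k + 1 := by
    rw [off_last, ← hsum, Fin.sum_univ_castSucc]
  have hcol (ρ : Fin (k + 1)) : gmM (k + 1) S r ρ (Fin.last k) =
      if off r (Fin.last m) ≤ (ρ : ℕ)
      then (rowPoly (k + 1) (S (Fin.last m))).coeff (ρ - off r (Fin.last m)) else 0 := by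
    have hρ := ρ.isLt
    rw [gmM, Matrix.of_apply, Fin.sum_univ_castSucc, Finset.sum_eq_zero, zero_add]
    · simp only [Fin.val_last, Nat.add_sub_cancel, Nat.sub_self, zero_add]
      exact if_congr (by omega) rfl rfl
    · intro i _
      have hi := hothers i
      refine ite_eq_right_iff.2 fun h => coeff_rowPoly_of_lt ?_
      simp only [Fin.val_last]
      omega
  rw [Matrix.det_eq_mul_det_submatrix_castSucc, hcol, Fin.val_last, if_pos (by omega),
    coeff_rowPoly_of_eq (by omega)]
  intro ρ
  have hρ := ρ.isLt
  rw [hcol, Fin.val_castSucc]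
  exact ite_eq_right_iff.2 fun h => coeff_rowPoly_of_lt (by omega)

theorem submatrix_gmM_eq_gmM_update {n k m : ℕ} (S : Fin (m + 1) → Finset (Fin n))
    (r : Fin (m + 1) → ℕ) (hsum : ∑ i, r i = k + 1) (hS : ∀ i, (S i).card + 1 ≤ k) :
    (gmM (k + 1) S r).submatrix Fin.castSucc Fin.castSucc =
      gmM k S (Function.update r (Fin.last m) (r (Fin.last m) - 1)) := by
  have hoff : off r (Fin.last m) + r (Fin.last m) = k + 1 := by
    rw [off_last, ← hsum, Fin.sum_univ_castSucc]
  ext ρ c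
  have hρ := ρ.isLt
  have hc := c.isLt
  simp only [gmM, Matrix.submatrix_apply, Matrix.of_apply, Fin.val_castSucc, off_update_last]
  refine Finset.sum_congr rfl fun i _ => ?_
  rw [show k + 1 - 1 - (c : ℕ) + (ρ - off r i) = k - 1 - c + (ρ - off r i) + 1 by omega,
    coeff_succ_rowPoly_succ (hS i)]
  refine if_congr ?_ rfl rfl
  obtain rfl | hi := eq_or_ne i (Fin.last m)
  · rw [Function.update_self]
    omega
  · rw [Function.update_of_ne hi]

theorem submatrix_gmM_eq_gmM_castSucc {n k m : ℕ} (S : Fin (m + 1) → Finset (Fin n))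
    (r : Fin (m + 1) → ℕ) (hsum : ∑ i, r i = k + 1) (hr : r (Fin.last m) = 1)
    (hS : ∀ i : Fin m, (S i.castSucc).card + 1 ≤ k) :
    (gmM (k + 1) S r).submatrix Fin.castSucc Fin.castSucc =
      gmM k (fun a : Fin m => S a.castSucc) (fun a : Fin m => r a.castSucc) := by
  have hoff : off r (Fin.last m) + r (Fin.last m) = k + 1 := by
    rw [off_last, ← hsum, Fin.sum_univ_castSucc]
  ext ρ c
  have hρ := ρ.isLt
  have hc := c.isLt
  simp only [gmM, Matrix.submatrix_apply, Matrix.of_apply, Fin.val_castSucc]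
  rw [Fin.sum_univ_castSucc, if_neg (by omega), add_zero]
  refine Finset.sum_congr rfl fun i _ => ?_
  rw [off_castSucc, show k + 1 - 1 - (c : ℕ) + (ρ - off (fun a : Fin m => r a.castSucc) i) =
      k - 1 - c + (ρ - off (fun a : Fin m => r a.castSucc) i) + 1 by omega,
    coeff_succ_rowPoly_succ (hS i)]

/-- **Case 2 of the induction (determinant expansion along the last column).**
Suppose `[(S_i,r_i)]_{i=1}^m ∈ 𝒮_{k,m,n}` with `|S_m| + r_m = k` and
`|S_i| + r_i < k` for `i < m`.  If `r_m ≥ 2`, then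
`det M[(S_i,r_i)]_{i=1}^m = (∏_{j∈S_m} α_j) ⬝ det M[(S_1,r_1),…,(S_m,r_m-1)]`,
the latter being the `(k-1)×(k-1)` matrix built with `k-1` in place of `k`.
If `r_m = 1` and `m ≥ 2`, then
`det M[(S_i,r_i)]_{i=1}^m = (∏_{j∈S_m} α_j) ⬝ det M[(S_i,r_i)]_{i=1}^{m-1}`,
the latter again built with `k-1` in place of `k`. -/
theorem stmt_11 {k m n : ℕ} (hm : 1 ≤ m) (hmk : m ≤ k)
    (S : Fin m → Finset (Fin n)) (r : Fin m → ℕ)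
    (hr : ∀ i, 1 ≤ r i) (hcard : ∀ i, (S i).card + r i ≤ k) (hsum : ∑ i, r i = k)
    (hlast : (S ⟨m - 1, by omega⟩).card + r ⟨m - 1, by omega⟩ = k)
    (hothers : ∀ i : Fin m, (i : ℕ) ≠ m - 1 → (S i).card + r i < k) :
    (2 ≤ r ⟨m - 1, by omega⟩ →
      (gmM k S r).det = (∏ j ∈ S ⟨m - 1, by omega⟩, alf j) *
        (gmM (k - 1) S
          (Function.update r ⟨m - 1, by omega⟩ (r ⟨m - 1, by omega⟩ - 1))).det) ∧
    (r ⟨m - 1, by omega⟩ = 1 → 2 ≤ m →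
      (gmM k S r).det = (∏ j ∈ S ⟨m - 1, by omega⟩, alf j) *
        (gmM (k - 1) (fun a : Fin (m - 1) => S (Fin.castLE (by omega) a))
          (fun a : Fin (m - 1) => r (Fin.castLE (by omega) a))).det) := by
  obtain ⟨k, rfl⟩ := Nat.exists_eq_add_of_le' (hm.trans hmk)
  obtain ⟨m, rfl⟩ := Nat.exists_eq_add_of_le' hm
  change (S (Fin.last m)).card + r (Fin.last m) = k + 1 at hlast
  have hothers_lt (i : Fin m) : (S i.castSucc).card + r i.castSucc < k + 1 :=
    hothers i.castSucc i.isLt.ne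
  have hS (i : Fin m) : (S i.castSucc).card + 1 ≤ k := by
    have := hothers_lt i
    have := hr i.castSucc
    omega
  have hdet := det_gmM_succ S r (hr _) hsum hlast hothers_lt
  refine ⟨fun h => ?_, fun h _ => ?_⟩
  · change 2 ≤ r (Fin.last m) at h
    rw [submatrix_gmM_eq_gmM_update S r hsum (Fin.lastCases (by omega) hS)] at hdet
    exact hdet
  · rw [submatrix_gmM_eq_gmM_castSucc S r hsum h hS] at hdet
    exact hdet
end

section
/- Let [(S_i,r_i)]_{i=1}^m ∈ 𝒮_{k,m,n} satisfy the GM-MDS condition, and suppose |S_m| + r_m = k, r_m ≥ 2, and |S_i| + r_i < k for all i ∈ {1,…,m−1}. Define r'_m = r_m − 1 and r'_i = r_i for i ∈ {1,…,m−1}. Then [(S_i,r'_i)]_{i=1}^m ∈ 𝒮_{k−1,m,n} and [(S_i,r'_i)]_{i=1}^m satisfies the GM-MDS condition. -/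
/-- Decreasing one positive value of `r` at a point of `Ω` by one lowers the sum over `Ω` by one. -/
theorem sum_update_sub_one_add_one {ι : Type*} [DecidableEq ι] {Ω : Finset ι} {r : ι → ℕ} {l : ι}
    (hl : l ∈ Ω) (hr : 1 ≤ r l) :
    ∑ i ∈ Ω, Function.update r l (r l - 1) i + 1 = ∑ i ∈ Ω, r i := by
  rw [Finset.sum_update_of_mem hl, ← Finset.sum_sdiff (Finset.singleton_subset_iff.2 hl),
    Finset.sum_singleton]
  omega


/-- **Case 2, combinatorial part.** Suppose `[(S_i,r_i)]_{i=1}^m ∈ 𝒮_{k,m,n}`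
satisfies the GM-MDS condition, `|S_m| + r_m = k` with `r_m ≥ 2`, and
`|S_i| + r_i < k` for `i < m`.  With `r'_m = r_m - 1` and `r'_i = r_i` otherwise,
the family `[(S_i,r'_i)]_{i=1}^m` lies in `𝒮_{k-1,m,n}` and satisfies the GM-MDS
condition. -/
theorem stmt_12 {k m n : ℕ} (hm : 1 ≤ m) (hmk : m ≤ k)
    (S : Fin m → Finset (Fin n)) (r : Fin m → ℕ)
    (hr : ∀ i, 1 ≤ r i) (hcard : ∀ i, (S i).card + r i ≤ k) (hsum : ∑ i, r i = k)
    (hgm : ∀ Ω : Finset (Fin m), Ω.Nonempty →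
      (Ω.inf S).card + ∑ i ∈ Ω, r i ≤ Ω.sup fun i => (S i).card + r i)
    (hlast : (S ⟨m - 1, by omega⟩).card + r ⟨m - 1, by omega⟩ = k)
    (hr2 : 2 ≤ r ⟨m - 1, by omega⟩)
    (hothers : ∀ i : Fin m, (i : ℕ) ≠ m - 1 → (S i).card + r i < k) :
    (∀ i, 1 ≤ Function.update r ⟨m - 1, by omega⟩ (r ⟨m - 1, by omega⟩ - 1) i) ∧
    (∀ i, (S i).card
        + Function.update r ⟨m - 1, by omega⟩ (r ⟨m - 1, by omega⟩ - 1) i ≤ k - 1) ∧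
    (∑ i, Function.update r ⟨m - 1, by omega⟩ (r ⟨m - 1, by omega⟩ - 1) i = k - 1) ∧
    (∀ Ω : Finset (Fin m), Ω.Nonempty →
      (Ω.inf S).card
          + ∑ i ∈ Ω, Function.update r ⟨m - 1, by omega⟩ (r ⟨m - 1, by omega⟩ - 1) i
        ≤ Ω.sup fun i => (S i).card
          + Function.update r ⟨m - 1, by omega⟩ (r ⟨m - 1, by omega⟩ - 1) i) := by
  have hlt : ∀ i : Fin m, i ≠ ⟨m - 1, by omega⟩ → (S i).card + r i < k :=
    fun i hi => hothers i fun h => hi (Fin.ext h)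
  generalize (⟨m - 1, _⟩ : Fin m) = l at *
  refine ⟨fun i => ?_, fun i => ?_, ?_, fun Ω hΩ => ?_⟩
  · rcases eq_or_ne i l with rfl | hi
    · rw [Function.update_self]
      omega
    · rw [Function.update_of_ne hi]
      exact hr i
  · rcases eq_or_ne i l with rfl | hi
    · rw [Function.update_self]
      omega
    · rw [Function.update_of_ne hi]
      have := hlt i hi
      omega
  · have := sum_update_sub_one_add_one (Finset.mem_univ l) (hr l)
    omega
  · by_cases hl : l ∈ Ω
    · have hsup : k - 1 ≤ Ω.sup fun i => (S i).card + Function.update r l (r l - 1) i := by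
        refine le_trans ?_ (Finset.le_sup hl)
        rw [Function.update_self]
        omega
      have hle := (hgm Ω hΩ).trans (Finset.sup_le fun i _ => hcard i)
      have := sum_update_sub_one_add_one hl (hr l)
      omega
    · have heq : ∀ i ∈ Ω, Function.update r l (r l - 1) i = r i := fun i hi =>
        Function.update_of_ne (ne_of_mem_of_not_mem hi hl) _ _
      rw [Finset.sum_congr rfl heq,
        Finset.sup_congr rfl fun i hi => congrArg ((S i).card + ·) (heq i hi)]
      exact hgm Ω hΩ
end

section
/- Let n ≥ 1, m ≥ 2, and let [(S_i,r_i)]_{i=1}^m ∈ 𝒮_{k,m,n} satisfy the GM-MDS condition, with strict inequality |∩_{i∈Ω} S_i| + ∑_{i∈Ω} r_i < max_{i∈Ω}(|S_i| + r_i) for every Ω ⊆ {1,…,m} with 2 ≤ |Ω| ≤ m − 1. Suppose there exist distinct indices a ≠ b in {1,…,m} with |S_a| + r_a = |S_b| + r_b = k and n ∉ S_a. Then the family [(S_i ∖ {n}, r_i)]_{i=1}^m belongs to 𝒮_{k,m,n−1} and satisfies the GM-MDS condition. -/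
theorem Finset.card_inf_preimage_le {ι α β : Type*} [Fintype α] [DecidableEq α] [Fintype β]
    [DecidableEq β] {f : α → β} (hf : Function.Injective f) (S : ι → Finset β) (s : Finset ι) :
    (s.inf fun i => (S i).preimage f hf.injOn).card ≤ (s.inf S).card := by
  refine Finset.card_le_card_of_injOn f (fun x hx => ?_) hf.injOn
  simpa [Finset.mem_inf] using hx

theorem Fin.card_le_card_preimage_castLE_add {n : ℕ} (hn : 1 ≤ n) (s : Finset (Fin n)) :
    s.card ≤ (s.preimage (Fin.castLE (Nat.sub_le n 1)) ((Fin.castLE_injective _).injOn)).card +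
      if (⟨n - 1, by omega⟩ : Fin n) ∈ s then 1 else 0 := by
  set t := s.preimage (Fin.castLE (Nat.sub_le n 1)) ((Fin.castLE_injective _).injOn)
  have key : ∀ x ∈ s, x ≠ ⟨n - 1, by omega⟩ → x ∈ t.image (Fin.castLE (Nat.sub_le n 1)) := by
    intro x hx hne
    have hlt : x.val < n - 1 := by
      have : x.val ≠ n - 1 := fun h => hne (Fin.ext h)
      omega
    exact Finset.mem_image.2 ⟨⟨x, hlt⟩, Finset.mem_preimage.2 hx, rfl⟩
  have him : (t.image (Fin.castLE (Nat.sub_le n 1))).card ≤ t.card := Finset.card_image_le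
  split_ifs with h
  · have hsub : s.erase ⟨n - 1, by omega⟩ ⊆ t.image (Fin.castLE (Nat.sub_le n 1)) :=
      fun x hx => key x (Finset.mem_of_mem_erase hx) (Finset.ne_of_mem_erase hx)
    have := Finset.card_le_card hsub
    rw [Finset.card_erase_of_mem h] at this
    omega
  · have hsub : s ⊆ t.image (Fin.castLE (Nat.sub_le n 1)) :=
      fun x hx => key x hx fun hxn => h (hxn ▸ hx)
    have := Finset.card_le_card hsub
    omega

/-- **Case 3, combinatorial part.** Let `n ≥ 1`, `m ≥ 2`, and let
`[(S_i,r_i)]_{i=1}^m ∈ 𝒮_{k,m,n}` satisfy the GM-MDS condition, with strict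
inequality for every `Ω` with `2 ≤ |Ω| ≤ m-1`.  Suppose `a ≠ b` satisfy
`|S_a| + r_a = |S_b| + r_b = k` and `n ∉ S_a`.  Then the family
`[(S_i ∖ {n}, r_i)]_{i=1}^m` (with the sets viewed as subsets of `[n-1]`) lies in
`𝒮_{k,m,n-1}` and satisfies the GM-MDS condition. -/
theorem stmt_14 {k m n : ℕ} (hn : 1 ≤ n) (hm : 2 ≤ m) (hmk : m ≤ k)
    (S : Fin m → Finset (Fin n)) (r : Fin m → ℕ)
    (hr : ∀ i, 1 ≤ r i) (hcard : ∀ i, (S i).card + r i ≤ k) (hsum : ∑ i, r i = k)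
    (hgm : ∀ Ω : Finset (Fin m), Ω.Nonempty →
      (Ω.inf S).card + ∑ i ∈ Ω, r i ≤ Ω.sup fun i => (S i).card + r i)
    (hstrict : ∀ Ω : Finset (Fin m), 2 ≤ Ω.card → Ω.card ≤ m - 1 →
      (Ω.inf S).card + ∑ i ∈ Ω, r i < Ω.sup fun i => (S i).card + r i)
    (a b : Fin m) (hab : a ≠ b)
    (ha : (S a).card + r a = k) (hb : (S b).card + r b = k)
    (hna : (⟨n - 1, by omega⟩ : Fin n) ∉ S a) :
    (∀ i, ((S i).preimage (Fin.castLE (by omega : n - 1 ≤ n))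
        ((Fin.castLE_injective _).injOn)).card + r i ≤ k) ∧
    (∀ Ω : Finset (Fin m), Ω.Nonempty →
      (Ω.inf fun i => (S i).preimage (Fin.castLE (by omega : n - 1 ≤ n))
          ((Fin.castLE_injective _).injOn)).card + ∑ i ∈ Ω, r i
        ≤ Ω.sup fun i =>
          ((S i).preimage (Fin.castLE (by omega : n - 1 ≤ n))
            ((Fin.castLE_injective _).injOn)).card + r i) := by
  have hinj := Fin.castLE_injective (Nat.sub_le n 1)
  have hinf := Finset.card_inf_preimage_le hinj S
  have hle : ∀ i, ((S i).preimage _ hinj.injOn).card ≤ (S i).card := fun i => by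
    simpa using hinf {i}
  refine ⟨fun i => (Nat.add_le_add_right (hle i) _).trans (hcard i), fun Ω hΩ => ?_⟩
  have hinfΩ := hinf Ω
  have hsupT := fun i (hi : i ∈ Ω) =>
    Finset.le_sup (f := fun i => ((S i).preimage _ hinj.injOn).card + r i) hi
  rcases Nat.lt_or_ge Ω.card 2 with h1 | h2
  · have hcard1 : Ω.card = 1 := by
      have := hΩ.card_pos
      omega
    obtain ⟨i, rfl⟩ := Finset.card_eq_one.1 hcard1
    simp
  · by_cases h3 : Ω.card ≤ m - 1
    · have hlt := hstrict Ω h2 h3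
      obtain ⟨i, hi, hsup⟩ := Finset.exists_mem_eq_sup Ω hΩ fun i => (S i).card + r i
      have hT := hsupT i hi
      have hS := Fin.card_le_card_preimage_castLE_add hn (S i)
      have hif : (if (⟨n - 1, by omega⟩ : Fin n) ∈ S i then 1 else 0) ≤ 1 := by
        split_ifs <;> omega
      omega
    · have huniv : Ω = Finset.univ :=
        (Finset.card_eq_iff_eq_univ Ω).1 <| by
          have := Finset.card_le_univ Ω
          simp only [Fintype.card_fin] at this ⊢
          omega
      have hT := hsupT a (huniv ▸ Finset.mem_univ a)
      have hS := Fin.card_le_card_preimage_castLE_add hn (S a)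
      rw [if_neg hna] at hS
      have hgmΩ := hgm Ω hΩ
      have hsupS : (Ω.sup fun i => (S i).card + r i) ≤ k := Finset.sup_le fun i _ => hcard i
      omega
end
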